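/- arXiv:1310.4658 — 5 statements merged into one kernel-verified Lean document; each statement's English description precedes it below -/
import Mathlib

section
/- Let s and m be positive integers with m ≥ s+1, and let M be an (s+1)×m matrix with real entries; denote by c_1, …, c_m its columns from left to right. Assume that for every integer j with 0 ≤ j ≤ m−s−1 the s consecutive columns c_{j+1}, …, c_{j+s} are linearly independent, while the s+1 consecutive columns c_{j+1}, …, c_{j+s+1} are linearly dependent. Then the rank of M equals s. -/
/-- Let `s, m` be positive integers with `m ≥ s+1` and let `M` be an `(s+1) × m` real matrix
with columns `c₁, …, c_m`.  If for every `j` with `0 ≤ j ≤ m - s - 1` the consecutive columns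
`c_{j+1}, …, c_{j+s}` are linearly independent while `c_{j+1}, …, c_{j+s+1}` are linearly
dependent, then the rank of `M` equals `s`. -/
theorem casorati_rank (s m : ℕ) (hs : 0 < s) (hm : s + 1 ≤ m)
    (M : Matrix (Fin (s + 1)) (Fin m) ℝ)
    (hindep : ∀ j : ℕ, (hj : j + s + 1 ≤ m) →
      LinearIndependent ℝ
        (fun i : Fin s => fun r : Fin (s + 1) =>
          M r ⟨j + (i : ℕ), by have := i.isLt; omega⟩))
    (hdep : ∀ j : ℕ, (hj : j + s + 1 ≤ m) →
      ¬ LinearIndependent ℝ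
        (fun i : Fin (s + 1) => fun r : Fin (s + 1) =>
          M r ⟨j + (i : ℕ), by have := i.isLt; omega⟩)) :
    M.rank = s := by
  have key : ∀ k : ℕ, (hk : k < m) → (fun r => M r ⟨k, hk⟩) ∈
      Submodule.span ℝ (Set.range (fun i : Fin s => fun r : Fin (s + 1) =>
          M r ⟨0 + (i : ℕ), by have := i.isLt; omega⟩)) := by
    intro k
    induction k using Nat.strong_induction_on with
    | _ k ih =>
      intro hk
      by_cases hks : k < s
      · apply Submodule.subset_span
        refine ⟨⟨k, hks⟩, ?_⟩
        simp
      · have hj : (k - s) + s + 1 ≤ m := by omega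
        have hd := hdep (k - s) hj
        rw [linearIndependent_finSucc'] at hd
        have hmem := not_not.mp (fun h => hd ⟨hindep (k - s) hj, h⟩)
        have e : k - s + s = k := by omega
        have h2 : (fun r => M r ⟨k - s + s, by omega⟩) ∈
            Submodule.span ℝ (Set.range (fun i : Fin s => fun r : Fin (s + 1) =>
              M r ⟨0 + (i : ℕ), by have := i.isLt; omega⟩)) := by
          refine (Submodule.span_le.mpr ?_) hmem
          rintro _ ⟨i, rfl⟩
          have hi := i.isLt
          exact ih (k - s + i) (by omega) (by omega)
        simpa only [e] using h2
  have hspan : Submodule.span ℝ (Set.range M.col) =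
      Submodule.span ℝ (Set.range (fun i : Fin s => fun r : Fin (s + 1) =>
          M r ⟨0 + (i : ℕ), by have := i.isLt; omega⟩)) := by
    apply le_antisymm
    · rw [Submodule.span_le]
      rintro _ ⟨k, rfl⟩
      exact key k k.isLt
    · apply Submodule.span_mono
      rintro _ ⟨i, rfl⟩
      exact ⟨_, rfl⟩
  rw [Matrix.rank_eq_finrank_span_cols, hspan,
    finrank_span_eq_card (hindep 0 (by omega)), Fintype.card_fin]
end

section
/- Let c ∉ {0,−1,−2,…} be a real number and let 𝓕 = (F_1,F_2) be a pair of finite sets of positive integers, not both empty, with k = |F_1| + |F_2|. If c and 𝓕 are admissible, then c + k > 0. -/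
open Finset MeasureTheory Polynomial

/-- Generalized binomial coefficient `C(t, j) = t(t-1)⋯(t-j+1)/j!`. -/
noncomputable def gbinom (t : ℝ) (j : ℕ) : ℝ :=
  (∏ i ∈ Finset.range j, (t - i)) / (Nat.factorial j)

/-- Pochhammer symbol `(t)_m = t(t+1)⋯(t+m-1)`. -/
noncomputable def poch (t : ℝ) (m : ℕ) : ℝ := ∏ i ∈ Finset.range m, (t + i)

/-- Pochhammer symbol with integer index (Γ-quotient convention for negative index). -/
noncomputable def pochZ (t : ℝ) (m : ℤ) : ℝ :=
  if 0 ≤ m then ∏ i ∈ Finset.range m.toNat, (t + i)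
  else (∏ i ∈ Finset.range (-m).toNat, (t - (i + 1)))⁻¹

/-- `ĉ = max(-⌊c⌋, 0)`. -/
noncomputable def chat (c : ℝ) : ℕ := (-⌊c⌋).toNat

/-- Admissibility of `c` and the pair `𝓕 = (F₁, F₂)`. -/
def IsAdmissible (c : ℝ) (F1 F2 : Finset ℕ) : Prop :=
  ∀ x : ℕ, 0 ≤ (∏ f ∈ F1, ((x : ℝ) - f)) * (∏ f ∈ F2, ((x : ℝ) + c + f)) /
    poch ((x : ℝ) + c) (chat c)

/-- `u_𝓕 = ∑_{f∈F₁} f + ∑_{f∈F₂} f - C(k₁+1, 2) - C(k₂, 2)`. -/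
def uF (F1 F2 : Finset ℕ) : ℕ :=
  (∑ f ∈ F1, f + ∑ f ∈ F2, f) - (Nat.choose (F1.card + 1) 2 + Nat.choose F2.card 2)

/-- `σ_𝓕 = {u_𝓕, u_𝓕+1, …} \ {u_𝓕 + f : f ∈ F₁}`. -/
def sigmaF (F1 F2 : Finset ℕ) : Set ℕ :=
  {n | uF F1 F2 ≤ n ∧ ∀ f ∈ F1, n ≠ uF F1 F2 + f}

/-- The `i`-th element (0-based) of `F` in increasing order. -/
def nth (F : Finset ℕ) (i : ℕ) : ℕ := (F.sort (· ≤ ·)).getD i 0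
lemma sign_prod_aux {s : Finset ℕ} (g : ℕ → ℝ) (hg : ∀ i ∈ s, g i ≠ 0) :
    0 < (-1 : ℝ) ^ (s.filter (fun i => g i < 0)).card * ∏ i ∈ s, g i := by
  classical
  induction s using Finset.induction_on with
  | empty => simp
  | insert a s ha ih =>
    have ih' := ih (fun i hi => hg i (Finset.mem_insert_of_mem hi))
    have hga := hg a (Finset.mem_insert_self a s)
    rw [Finset.prod_insert ha, Finset.filter_insert]
    split_ifs with h
    · rw [Finset.card_insert_of_notMem (by simp [ha]), pow_succ]
      nlinarith [mul_pos ih' (neg_pos.mpr h)]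
    · have h' : 0 < g a := lt_of_le_of_ne (not_lt.mp h) hga.symm
      nlinarith [mul_pos ih' h']

/-- If `c ∉ {0, -1, -2, …}` and the pair `𝓕 = (F₁, F₂)` of finite sets of positive integers,
not both empty, is admissible together with `c`, then `c + k > 0` where `k = |F₁| + |F₂|`. -/
theorem admissible_c_add_k_pos (c : ℝ) (hc : ∀ n : ℕ, c ≠ -(n : ℝ))
    (F1 F2 : Finset ℕ) (hF1 : ∀ f ∈ F1, 0 < f) (hF2 : ∀ f ∈ F2, 0 < f)
    (hne : F1.Nonempty ∨ F2.Nonempty)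
    (hadm : IsAdmissible c F1 F2) :
    0 < c + ((F1.card + F2.card : ℕ) : ℝ) := by
  classical
  by_cases hpos : 0 < c
  · positivity
  have hc0 : c < 0 := lt_of_le_of_ne (not_lt.mp hpos) (by simpa using hc 0)
  obtain ⟨N, hN⟩ : ∃ N, N = chat c := ⟨_, rfl⟩
  have hfl : ⌊c⌋ < 0 := Int.floor_lt.mpr (by exact_mod_cast hc0)
  have hNz : (N : ℤ) = -⌊c⌋ := by rw [hN, chat]; omega
  have hNr : (N : ℝ) = -(⌊c⌋ : ℝ) := by exact_mod_cast hNz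
  have h1 : 0 < c + N := by
    have := Int.floor_le c
    have h2 := hc N
    refine lt_of_le_of_ne (by linarith) (fun h => h2 (by linarith))
  have h2 : c + N < 1 := by
    have := Int.lt_floor_add_one c
    linarith
  have key : ∀ m : ℕ, (m : ℝ) + c < 0 ↔ m < N := by
    intro m
    constructor
    · intro h
      have : (m : ℝ) < N := by linarith
      exact_mod_cast this
    · intro h
      have : (m : ℝ) + 1 ≤ N := by exact_mod_cast h
      linarith
  have knz : ∀ m : ℕ, (m : ℝ) + c ≠ 0 := fun m h => hc m (by linarith)
  have par : ∀ x : ℕ, x ≤ N → x ∉ F1 →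
      Even ((F1.filter (fun f => x < f)).card + (F2.filter (fun f => x + f < N)).card
        + (N - x)) := by
    intro x hx hxF
    have a1 := sign_prod_aux (s := F1) (fun f => (x : ℝ) - f) (by
      intro f hf h
      have : (x : ℝ) = f := by linarith
      exact hxF (by rw [Nat.cast_inj.mp this]; exact hf))
    have a2 := sign_prod_aux (s := F2) (fun f => (x : ℝ) + c + f) (by
      intro f hf h
      exact knz (x + f) (by push_cast; linarith))
    have a3 := sign_prod_aux (s := Finset.range N) (fun f => (x : ℝ) + c + f) (by
      intro f hf h
      exact knz (x + f) (by push_cast; linarith))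
    have e2 : ∀ f : ℕ, (x : ℝ) + c + f < 0 ↔ x + f < N := by
      intro f
      rw [← key (x + f)]
      push_cast
      rw [add_right_comm]
    have e3 : (Finset.range N).filter (fun f => x + f < N) = Finset.range (N - x) := by
      ext f
      simp only [Finset.mem_filter, Finset.mem_range]
      omega
    simp only [e2] at a2 a3
    rw [e3, Finset.card_range] at a3
    simp only [sub_neg, Nat.cast_lt] at a1
    have hx' := hadm x
    rw [← hN, poch] at hx'
    by_contra hodd
    rw [Nat.not_even_iff_odd] at hodd
    have hm := mul_pos (mul_pos a1 a2) a3
    have hs := hodd.neg_one_pow (α := ℝ)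
    rw [pow_add, pow_add] at hs
    generalize (∏ f ∈ F1, ((x : ℝ) - f)) = P at *
    generalize (∏ f ∈ F2, ((x : ℝ) + c + f)) = Q at *
    generalize (∏ f ∈ Finset.range N, ((x : ℝ) + c + f)) = R at *
    generalize (-1 : ℝ) ^ (F1.filter (fun f => x < f)).card = u at *
    generalize (-1 : ℝ) ^ (F2.filter (fun f => x + f < N)).card = v at *
    generalize (-1 : ℝ) ^ (N - x) = w at *
    have hlt : P * Q * R < 0 := by
      have : u * P * (v * Q) * (w * R) = -(P * Q * R) := by
        linear_combination (P * Q * R) * hs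
      linarith
    have hR : R ≠ 0 := fun h => by simp [h] at hlt
    have : P * Q * R = P * Q / R * R ^ 2 := by field_simp
    have := mul_nonneg hx' (sq_nonneg R)
    linarith
  have main : ∀ d : ℕ, d ≤ N →
      d ≤ (F1.filter (fun f => N - d < f)).card + (F2.filter (fun f => N - d + f < N)).card
        + (if N - d ∈ F1 then 1 else 0) := by
    intro d
    induction d with
    | zero => intro _; omega
    | succ d ih =>
      intro hd
      have ih := ih (by omega)
      obtain ⟨x, hx⟩ : ∃ x, x = N - (d + 1) := ⟨_, rfl⟩
      have hx1 : N - d = x + 1 := by omega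
      rw [← hx]
      rw [hx1] at ih
      have hB : (F2.filter (fun f => x + 1 + f < N)).card ≤
          (F2.filter (fun f => x + f < N)).card := by
        apply Finset.card_le_card
        intro f
        simp only [Finset.mem_filter]
        rintro ⟨h, h'⟩
        exact ⟨h, by omega⟩
      have hA : (F1.filter (fun f => x + 1 < f)).card + (if x + 1 ∈ F1 then 1 else 0) ≤
          (F1.filter (fun f => x < f)).card := by
        split_ifs with h
        · rw [← Finset.card_insert_of_notMem (s := F1.filter (fun f => x + 1 < f))
            (a := x + 1) (by simp)]
          apply Finset.card_le_card
          intro f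
          simp only [Finset.mem_insert, Finset.mem_filter]
          rintro (rfl | ⟨h, h'⟩)
          · exact ⟨h, by omega⟩
          · exact ⟨h, by omega⟩
        · apply Finset.card_le_card
          intro f
          simp only [Finset.mem_filter]
          rintro ⟨h, h'⟩
          exact ⟨h, by omega⟩
      by_cases hxF : x ∈ F1
      · rw [if_pos hxF]
        omega
      · rw [if_neg hxF]
        have := par x (by omega) hxF
        rw [Nat.even_iff] at this
        omega
  have hfin := main N le_rfl
  have h0 : (0 : ℕ) ∉ F1 := fun h => absurd (hF1 0 h) (lt_irrefl 0)
  rw [Nat.sub_self, if_neg h0] at hfin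
  have c1 := Finset.card_filter_le F1 (fun f => 0 < f)
  have c2 := Finset.card_filter_le F2 (fun f => 0 + f < N)
  have hk : N ≤ F1.card + F2.card := by omega
  have hk' : (N : ℝ) ≤ ((F1.card + F2.card : ℕ) : ℝ) := by exact_mod_cast hk
  linarith
end

section
/- Let c ∉ {0,−1,−2,…} be a real number and let 𝓕 = (F_1,F_2) be a pair of finite sets of positive integers with F_1 = ∅ and F_2 ≠ ∅. Then c and 𝓕 are admissible if and only if c > 0. -/
open Finset MeasureTheory Polynomial

/-- For `c ∉ {0, -1, -2, …}` and a pair `𝓕 = (F₁, F₂)` of finite sets of positive integers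
with `F₁ = ∅` and `F₂ ≠ ∅`: `c` and `𝓕` are admissible if and only if `c > 0`. -/
theorem admissible_iff_of_empty_left (c : ℝ) (hc : ∀ n : ℕ, c ≠ -(n : ℝ))
    (F2 : Finset ℕ) (hF2 : ∀ f ∈ F2, 0 < f) (hF2ne : F2.Nonempty) :
    IsAdmissible c ∅ F2 ↔ 0 < c := by
  constructor
  · intro h
    by_contra hneg
    have h0 : c < 0 := lt_of_le_of_ne (not_lt.mp hneg) (by simpa using hc 0)
    have hfl : ⌊c⌋ < 0 := Int.floor_lt.mpr (by simpa using h0)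
    obtain ⟨m, hm⟩ : ∃ m : ℕ, chat c = m + 1 :=
      ⟨chat c - 1, by unfold chat; omega⟩
    have hm' : ⌊c⌋ = -((m : ℤ) + 1) := by unfold chat at hm; omega
    have hle := Int.floor_le c
    have hlt := Int.lt_floor_add_one c
    rw [hm'] at hle hlt
    push_cast at hle hlt
    have hne := hc (m + 1)
    push_cast at hne
    have h1 : 0 < (m : ℝ) + c + 1 := by
      rcases lt_or_eq_of_le hle with h | h
      · linarith
      · exact absurd h.symm hne
    have h2 : (m : ℝ) + c < 0 := by linarith
    have hx := h m
    rw [hm, poch, Finset.prod_range_succ'] at hx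
    have hA : 0 < ∏ f ∈ F2, ((m : ℝ) + c + f) := Finset.prod_pos fun f hf => by
      have : (1 : ℝ) ≤ f := by exact_mod_cast hF2 f hf
      linarith
    have hB : 0 < ∏ k ∈ Finset.range m, ((m : ℝ) + c + ((k + 1 : ℕ) : ℝ)) :=
      Finset.prod_pos fun k _ => by
        have : (0 : ℝ) ≤ k := Nat.cast_nonneg k
        push_cast
        linarith
    rw [Finset.prod_empty, one_mul] at hx
    have hC : (m : ℝ) + c + ((0 : ℕ) : ℝ) < 0 := by simpa using h2
    exact absurd hx (not_le.mpr (div_neg_of_pos_of_neg hA (mul_neg_of_pos_of_neg hB hC)))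
  · intro h x
    unfold poch
    rw [Finset.prod_empty, one_mul]
    apply div_nonneg <;> exact Finset.prod_nonneg fun i _ => by positivity
end

section
/- Let c ∉ {0,−1,−2,…} be a real number and let 𝓕 = (F_1,F_2) be a pair of finite sets of positive integers, not both empty. If c and 𝓕 are admissible, then c + s_𝓕 and the pair 𝓕_⇓ are admissible. -/
open Finset MeasureTheory Polynomial

/-- `s_F`: `1` if `F = ∅`, `k+1` if `F = {1, …, k}`, and `min {s ≥ 1 : s < f_s}` otherwise
(where `f_1 < f_2 < ⋯` are the elements of `F` in increasing order). -/
noncomputable def sF (F : Finset ℕ) : ℕ :=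
  if F = ∅ then 1
  else if F = Finset.Icc 1 F.card then F.card + 1
  else sInf {s : ℕ | 1 ≤ s ∧ s < (F.sort (· ≤ ·)).getD (s - 1) 0}

/-- `F_⇓`: the empty set if `F = ∅` or `F = {1, …, k}`, and
`{f_{s_F} - s_F, …, f_k - s_F}` otherwise. -/
noncomputable def Fdown (F : Finset ℕ) : Finset ℕ :=
  if F = ∅ ∨ F = Finset.Icc 1 F.card then ∅
  else (((F.sort (· ≤ ·)).drop (sF F - 1)).map (fun f => f - sF F)).toFinset

/-- Combinatorial description of `s_F` and `F_⇓`. -/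
theorem sF_spec (F : Finset ℕ) (hF : ∀ f ∈ F, 0 < f) :
    1 ≤ sF F ∧ (sF F ∉ F) ∧
      Fdown F = (F.filter (fun f => sF F < f)).image (fun f => f - sF F) := by
  by_cases h0 : F = ∅
  · subst h0
    simp [sF, Fdown]
  by_cases h1 : F = Finset.Icc 1 F.card
  · have hs : sF F = F.card + 1 := by
      unfold sF; rw [if_neg h0, if_pos h1]
    have hd : Fdown F = ∅ := by
      unfold Fdown; rw [if_pos (Or.inr h1)]
    have hm : ∀ f ∈ F, f ≤ F.card := by
      intro f hf
      rw [h1] at hf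
      exact (Finset.mem_Icc.mp hf).2
    rw [hs, hd]
    refine ⟨by omega, fun h => ?_, ?_⟩
    · have := hm _ h
      omega
    · symm
      rw [Finset.image_eq_empty, Finset.filter_eq_empty_iff]
      intro f hf
      have := hm f hf
      omega
  set l := F.sort (· ≤ ·) with hl
  have hlen : l.length = F.card := by simp [hl]
  have hmem : ∀ f, f ∈ l ↔ f ∈ F := by intro f; simp [hl]
  have hsort : ∀ i j (hi : i < l.length) (hj : j < l.length), i < j → l[i] < l[j] := by
    intro i j hi hj hij
    have := F.sortedLT_sort
    exact List.pairwise_iff_getElem.mp this.pairwise i j hi hj hij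
  have hge : ∀ i (hi : i < l.length), i + 1 ≤ l[i] := by
    intro i
    induction i with
    | zero =>
      intro hi
      exact hF _ ((hmem _).mp (List.getElem_mem hi))
    | succ n ih =>
      intro hi
      have a := ih (by omega)
      have b := hsort n (n+1) (by omega) hi (by omega)
      omega
  have hsdef : sF F = sInf {s : ℕ | 1 ≤ s ∧ s < l.getD (s - 1) 0} := by
    unfold sF; rw [if_neg h0, if_neg h1]
  have hSne : {s : ℕ | 1 ≤ s ∧ s < l.getD (s - 1) 0}.Nonempty := by
    by_contra hcon
    rw [Set.not_nonempty_iff_eq_empty, Set.eq_empty_iff_forall_notMem] at hcon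
    apply h1
    apply Finset.eq_of_subset_of_card_le
    · intro f hf
      obtain ⟨i, hi, rfl⟩ := List.getElem_of_mem ((hmem f).mpr hf)
      have a := hge i hi
      have b := hcon (i+1)
      simp [List.getElem?_eq_getElem hi] at b
      rw [Finset.mem_Icc]
      omega
    · simp
  have hin := Nat.sInf_mem hSne
  have hmin : ∀ m, m < sF F → ¬ (1 ≤ m ∧ m < l.getD (m - 1) 0) := by
    intro m hm
    rw [hsdef] at hm
    exact Nat.notMem_of_lt_sInf hm
  rw [← hsdef] at hin
  have hdown : Fdown F = ((l.drop (sF F - 1)).map (fun f => f - sF F)).toFinset := by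
    unfold Fdown; rw [if_neg (by tauto)]
  rw [hdown]
  generalize sF F = s at *
  obtain ⟨hs1, hs2⟩ := hin
  have hsl : s - 1 < l.length := by
    by_contra h
    rw [List.getD_eq_default _ _ (by omega)] at hs2
    omega
  rw [List.getD_eq_getElem _ _ hsl] at hs2
  have hlow : ∀ i (hi : i < l.length), i < s - 1 → l[i] ≤ i + 1 := by
    intro i hi his
    have := hmin (i+1) (by omega)
    simp [List.getElem?_eq_getElem hi] at this
    omega
  have hhigh : ∀ i (hi : i < l.length), s - 1 ≤ i → s < l[i] := by
    intro i hi his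
    rcases Nat.eq_or_lt_of_le his with h | h
    · subst h; exact hs2
    · have := hsort _ _ hsl hi h
      omega
  refine ⟨hs1, fun h => ?_, ?_⟩
  · obtain ⟨i, hi, h⟩ := List.getElem_of_mem ((hmem s).mpr h)
    by_cases his : i < s - 1
    · have := hlow i hi his; omega
    · have := hhigh i hi (by omega); omega
  · ext y
    simp only [List.mem_toFinset, List.mem_map, Finset.mem_image, Finset.mem_filter]
    constructor
    · rintro ⟨f, hf, rfl⟩
      obtain ⟨i, hi, rfl⟩ := List.getElem_of_mem hf
      rw [List.length_drop] at hi
      rw [List.getElem_drop]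
      exact ⟨_, ⟨(hmem _).mp (List.getElem_mem _), hhigh _ (by omega) (by omega)⟩, rfl⟩
    · rintro ⟨f, ⟨hf, hsf⟩, rfl⟩
      obtain ⟨i, hi, rfl⟩ := List.getElem_of_mem ((hmem f).mpr hf)
      refine ⟨_, ?_, rfl⟩
      by_cases his : i < s - 1
      · have := hlow i hi his; omega
      · rw [List.mem_drop_iff_getElem]
        exact ⟨i - (s - 1), by omega, by congr 1; omega⟩

/-- If `c ∉ {0, -1, -2, …}` and the pair `𝓕 = (F₁, F₂)` of finite sets of positive integers,
not both empty, is admissible together with `c`, then `c + s_𝓕` and `𝓕_⇓ = ((F₁)_⇓, F₂)`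
are admissible. -/
theorem admissible_down (c : ℝ) (hc : ∀ n : ℕ, c ≠ -(n : ℝ))
    (F1 F2 : Finset ℕ) (hF1 : ∀ f ∈ F1, 0 < f) (hF2 : ∀ f ∈ F2, 0 < f)
    (hne : F1.Nonempty ∨ F2.Nonempty)
    (hadm : IsAdmissible c F1 F2) :
    IsAdmissible (c + (sF F1 : ℝ)) (Fdown F1) F2 := by
  obtain ⟨hs1, hsF, hdown⟩ := sF_spec F1 hF1
  rw [hdown]
  generalize sF F1 = s at *
  intro y
  have key := hadm (y + s)
  have e1 : ∏ f ∈ (F1.filter (fun f => s < f)).image (fun f => f - s), ((y : ℝ) - f)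
      = ∏ f ∈ F1.filter (fun f => s < f), (((y + s : ℕ) : ℝ) - f) := by
    rw [Finset.prod_image]
    · apply Finset.prod_congr rfl
      intro f hf
      have := (Finset.mem_filter.mp hf).2
      rw [Nat.cast_sub this.le]
      push_cast; ring
    · intro a ha b hb hab
      have h1 := (Finset.mem_filter.mp ha).2
      have h2 := (Finset.mem_filter.mp hb).2
      simp only at hab
      omega
  have e2 : 0 < ∏ f ∈ F1.filter (fun f => ¬ s < f), (((y + s : ℕ) : ℝ) - f) := by
    apply Finset.prod_pos
    intro f hf
    obtain ⟨h1, h2⟩ := Finset.mem_filter.mp hf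
    have h3 : f ≠ s := fun h => hsF (h ▸ h1)
    have h4 : f < y + s := by omega
    have : (f : ℝ) < ((y + s : ℕ) : ℝ) := by exact_mod_cast h4
    linarith
  have e3 := Finset.prod_filter_mul_prod_filter_not F1 (fun f => s < f)
    (fun f => (((y + s : ℕ) : ℝ) - f))
  have hfl : ⌊c + (s : ℝ)⌋ = ⌊c⌋ + s := Int.floor_add_natCast c s
  have hle : chat (c + s) ≤ chat c := by
    unfold chat; rw [hfl]; omega
  have e4 : poch (((y + s : ℕ) : ℝ) + c) (chat c) = poch (((y + s : ℕ) : ℝ) + c) (chat (c + s)) *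
      ∏ i ∈ Finset.Ico (chat (c + s)) (chat c), (((y + s : ℕ) : ℝ) + c + i) := by
    unfold poch
    rw [Finset.prod_range_mul_prod_Ico _ hle]
  have e5 : 0 < ∏ i ∈ Finset.Ico (chat (c + s)) (chat c), (((y + s : ℕ) : ℝ) + c + i) := by
    apply Finset.prod_pos
    intro i hi
    have h1 := (Finset.mem_Ico.mp hi).1
    have h2 : (0 : ℤ) ≤ s + ⌊c⌋ + i := by
      unfold chat at h1; rw [hfl] at h1; omega
    have h3 : (0 : ℝ) ≤ s + ⌊c⌋ + i := by exact_mod_cast h2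
    have h4 := Int.floor_le c
    have h5 := hc (y + s + i)
    push_cast at h5 ⊢
    have h6 : (0 : ℝ) ≤ y := Nat.cast_nonneg y
    apply lt_of_le_of_ne
    · linarith
    · intro h
      apply h5
      linarith
  have e6 : (y : ℝ) + (c + s) = ((y + s : ℕ) : ℝ) + c := by push_cast; ring
  rw [e1, e6]
  rw [← e3, e4] at key
  generalize (∏ i ∈ Finset.Ico (chat (c + s)) (chat c), (((y + s : ℕ) : ℝ) + c + i)) = P at *
  generalize (∏ f ∈ F1.filter (fun f => ¬ s < f), (((y + s : ℕ) : ℝ) - f)) = Q at *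
  generalize (∏ f ∈ F1.filter (fun f => s < f), (((y + s : ℕ) : ℝ) - f)) = A at *
  generalize (∏ f ∈ F2, (((y + s : ℕ) : ℝ) + c + f)) = B at *
  generalize poch (((y + s : ℕ) : ℝ) + c) (chat (c + s)) = D at *
  have e7 : A * Q * B / (D * P) = (A * B / D) * (Q / P) := by
    rw [div_mul_div_comm]; ring
  rw [e7] at key
  exact nonneg_of_mul_nonneg_left key (div_pos e2 e5)
end

section
/- Let a ∉ {0,1} and c ∉ {0,−1,−2,…} be real numbers and 𝓕 = (F_1,F_2) a pair of finite sets of positive integers, not both empty. For every u ∈ ℕ and every v ∈ σ_𝓕, one has q_u^𝓕(v) = κ·ξ_u·ζ_v·m_v^{a,c;𝓕}(u), where κ = (−1)^{∑_{f∈F_2}f}·a^{k_2(k_1+1)+∑_{f∈F_2}f}·∏_{f∈F_1}f!·∏_{f∈F_2}f! / ((a−1)^{k_2(k_1+1)}·∏_{f∈F_1}(1+c)_{f−1}·∏_{f∈F_2}(1+c)_{f−1}), ξ_u = a^{(k_1+1)u}·∏_{i=0}^{k}(1+c)_{u+i−1} / ((a−1)^{(k+1)u}·∏_{i=0}^{k}(u+i)!),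 and ζ_v = (a−1)^{v}·(v−u_𝓕)! / (a^{v}·(1+c)_{v−u_𝓕−1}·∏_{f∈F_1}(v−f−u_𝓕)·∏_{f∈F_2}(v+c+f−u_𝓕)), with (t)_m = t(t+1)⋯(t+m−1) the Pochhammer symbol and (t)_{−1} understood via (t)_{m} = Γ-quotient convention (1+c)_{−1} = 1/c. -/
open Finset MeasureTheory Polynomial

/-- The Meixner polynomial `m_n^{a,c}` evaluated at `x`. -/
noncomputable def meixner (a c : ℝ) (n : ℕ) (x : ℝ) : ℝ :=
  (a / (1 - a)) ^ n *
    ∑ j ∈ Finset.range (n + 1), a ^ (-(j : ℤ)) * gbinom x j * gbinom (-x - c) (n - j)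

/-- The polynomial `m_n^{a,c;𝓕}` (Casorati determinant of Meixner polynomials). -/
noncomputable def mExc (a c : ℝ) (F1 F2 : Finset ℕ) (n : ℕ) (x : ℝ) : ℝ :=
  Matrix.det (Matrix.of fun i j : Fin (F1.card + F2.card + 1) =>
    if (i : ℕ) = 0 then meixner a c (n - uF F1 F2) (x + ((j : ℕ) : ℝ))
    else if (i : ℕ) - 1 < F1.card then meixner a c (nth F1 ((i : ℕ) - 1)) (x + ((j : ℕ) : ℝ))
    else a ^ (-((j : ℕ) : ℤ)) *
      meixner a⁻¹ c (nth F2 ((i : ℕ) - 1 - F1.card)) (x + ((j : ℕ) : ℝ)))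

/-- The Casorati determinant `Ω_𝓕^{a,c}(x)`. -/
noncomputable def OmegaM (a c : ℝ) (F1 F2 : Finset ℕ) (x : ℝ) : ℝ :=
  Matrix.det (Matrix.of fun i j : Fin (F1.card + F2.card) =>
    if (i : ℕ) < F1.card then meixner a c (nth F1 (i : ℕ)) (x + ((j : ℕ) : ℝ))
    else a ^ (-((j : ℕ) : ℤ)) *
      meixner a⁻¹ c (nth F2 ((i : ℕ) - F1.card)) (x + ((j : ℕ) : ℝ)))

/-- The determinant `Λ_𝓕^{a,c}(x)` (columns `0, …, k-2, k`). -/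
noncomputable def LambdaM (a c : ℝ) (F1 F2 : Finset ℕ) (x : ℝ) : ℝ :=
  Matrix.det (Matrix.of fun i j : Fin (F1.card + F2.card) =>
    let col : ℕ := if (j : ℕ) = F1.card + F2.card - 1 then F1.card + F2.card else (j : ℕ)
    if (i : ℕ) < F1.card then meixner a c (nth F1 (i : ℕ)) (x + (col : ℝ))
    else a ^ (-(col : ℤ)) *
      meixner a⁻¹ c (nth F2 ((i : ℕ) - F1.card)) (x + (col : ℝ)))
/-- The polynomial `q_n^𝓕` (Christoffel-transform dual of `m_n^{a,c;𝓕}`). -/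
noncomputable def qExc (a c : ℝ) (F1 F2 : Finset ℕ) (n : ℕ) (x : ℝ) : ℝ :=
  Matrix.det (Matrix.of fun i j : Fin (F1.card + F2.card + 1) =>
    if (i : ℕ) = 0 then meixner a c (n + (j : ℕ)) (x - (uF F1 F2 : ℝ))
    else if (i : ℕ) - 1 < F1.card then
      meixner a c (n + (j : ℕ)) ((nth F1 ((i : ℕ) - 1) : ℝ))
    else (-1 : ℝ) ^ (j : ℕ) *
      meixner a⁻¹ c (n + (j : ℕ)) ((nth F2 ((i : ℕ) - 1 - F1.card) : ℝ))) /
  ((-1 : ℝ) ^ (n * F2.card) * (∏ f ∈ F1, (x - (f : ℝ) - (uF F1 F2 : ℝ))) *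
    ∏ f ∈ F2, (x + c + (f : ℝ) - (uF F1 F2 : ℝ)))

/-- The second order difference operator `D_𝓕` of Theorem 3.3. -/
noncomputable def DopM (a c : ℝ) (F1 F2 : Finset ℕ) (g : ℝ → ℝ) (x : ℝ) : ℝ :=
  (x * OmegaM a c F1 F2 (x + 1) / ((a - 1) * OmegaM a c F1 F2 x)) * g (x - 1)
  + (-((1 + a) * (x + ((F1.card + F2.card : ℕ) : ℝ)) + a * c) / (a - 1) + (uF F1 F2 : ℝ)
      + a * (x + c + ((F1.card + F2.card : ℕ) : ℝ)) * LambdaM a c F1 F2 (x + 1) /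
          ((a - 1) * OmegaM a c F1 F2 (x + 1))
      - a * (x + c + ((F1.card + F2.card : ℕ) : ℝ) - 1) * LambdaM a c F1 F2 x /
          ((a - 1) * OmegaM a c F1 F2 x)) * g x
  + (a * (x + c + ((F1.card + F2.card : ℕ) : ℝ)) * OmegaM a c F1 F2 x /
      ((a - 1) * OmegaM a c F1 F2 (x + 1))) * g (x + 1)

/-- The weight `w(x) = aˣ Γ(x+c+k)/(x! Ω(x) Ω(x+1))` on `ℕ`. -/
noncomputable def wM (a c : ℝ) (F1 F2 : Finset ℕ) (x : ℕ) : ℝ :=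
  a ^ x * Real.Gamma ((x : ℝ) + c + ((F1.card + F2.card : ℕ) : ℝ)) /
    ((Nat.factorial x : ℝ) * OmegaM a c F1 F2 (x : ℝ) * OmegaM a c F1 F2 ((x : ℝ) + 1))

lemma gbinom_zero (t : ℝ) : gbinom t 0 = 1 := by simp [gbinom]

lemma gbinom_zero_succ (j : ℕ) : gbinom 0 (j + 1) = 0 := by
  simp [gbinom, Finset.prod_range_succ']

lemma gbinom_succ (t : ℝ) (j : ℕ) :
    gbinom (t + 1) (j + 1) = gbinom t (j + 1) + gbinom t j := by
  unfold gbinom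
  rw [Finset.prod_range_succ', Finset.prod_range_succ, Nat.factorial_succ]
  have h : ∀ i ∈ Finset.range j, (t + 1 - ((i + 1 : ℕ) : ℝ)) = t - i := by
    intro i _; push_cast; ring
  rw [Finset.prod_congr rfl h]
  have : (Nat.factorial j : ℝ) ≠ 0 := by positivity
  have : (j : ℝ) + 1 ≠ 0 := by positivity
  push_cast
  field_simp
  ring

/-- The convolution sum in the Meixner polynomial. -/
noncomputable def mT (b c : ℝ) (n : ℕ) (x : ℝ) : ℝ :=
  ∑ j ∈ Finset.range (n + 1), b ^ j * gbinom x j * gbinom (-x - c) (n - j)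

lemma mT_rec (b c : ℝ) (n : ℕ) (x : ℝ) :
    mT b c (n + 1) (x + 1) + mT b c n (x + 1) = mT b c (n + 1) x + b * mT b c n x := by
  have hy : -x - c = (-(x + 1) - c) + 1 := by ring
  have h1 : mT b c (n + 1) (x + 1) + mT b c n (x + 1) =
      ∑ j ∈ Finset.range (n + 2), b ^ j * gbinom (x + 1) j * gbinom (-x - c) (n + 1 - j) := by
    unfold mT
    rw [Finset.sum_range_succ, Finset.sum_range_succ _ (n + 1)]
    rw [add_right_comm, ← Finset.sum_add_distrib]
    congr 1
    · apply Finset.sum_congr rfl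
      intro j hj
      have hj' : j ≤ n := by simpa [Nat.lt_succ_iff] using hj
      rw [Nat.succ_sub hj', hy, gbinom_succ]
      ring
    · simp [gbinom_zero]
  rw [h1]
  unfold mT
  rw [Finset.sum_range_succ', Finset.sum_range_succ' _ (n + 1), Finset.mul_sum,
    add_right_comm, ← Finset.sum_add_distrib]
  congr 1
  · apply Finset.sum_congr rfl
    intro j _
    rw [gbinom_succ, Nat.add_sub_add_right]
    ring

/-- `(c)_n / n!`. -/
noncomputable def mP (c : ℝ) (n : ℕ) : ℝ := poch c n / (Nat.factorial n : ℝ)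

lemma poch_ne (c : ℝ) (hc : ∀ n : ℕ, c ≠ -(n : ℝ)) (n : ℕ) : poch c n ≠ 0 := by
  unfold poch
  rw [Finset.prod_ne_zero_iff]
  intro i _ h
  exact hc i (by linarith)

lemma mP_ne (c : ℝ) (hc : ∀ n : ℕ, c ≠ -(n : ℝ)) (n : ℕ) : mP c n ≠ 0 :=
  div_ne_zero (poch_ne c hc n) (by positivity)

lemma poch_succ (c : ℝ) (n : ℕ) : poch c (n + 1) = poch c n * (c + n) := by
  simp [poch, Finset.prod_range_succ]

lemma mT_zero (b c : ℝ) (n : ℕ) : mT b c n 0 = (-1) ^ n * mP c n := by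
  unfold mT
  rw [Finset.sum_range_succ']
  simp only [gbinom_zero_succ, gbinom_zero]
  simp only [mul_zero, zero_mul, Finset.sum_const_zero, pow_zero, Nat.sub_zero, mul_one, one_mul,
    zero_add]
  unfold gbinom mP poch
  rw [← mul_div_assoc]
  congr 1
  induction n with
  | zero => simp
  | succ n ih => rw [Finset.prod_range_succ, Finset.prod_range_succ, ih]; ring

/-- Hypergeometric sum, symmetric in `n` and `x`. -/
noncomputable def mR (N : ℕ) (z c : ℝ) (n x : ℕ) : ℝ :=
  ∑ k ∈ Finset.range (N + 1),
    (n.choose k : ℝ) * (x.choose k : ℝ) * ((k.factorial : ℝ) / poch c k * z ^ k)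

lemma mR_symm (N : ℕ) (z c : ℝ) (n x : ℕ) : mR N z c n x = mR N z c x n := by
  unfold mR
  exact Finset.sum_congr rfl fun k _ => by ring

lemma mR_zero_left (N : ℕ) (z c : ℝ) (x : ℕ) : mR N z c 0 x = 1 := by
  unfold mR
  rw [Finset.sum_range_succ']
  simp [poch]

lemma mR_diff (N : ℕ) (z c : ℝ) (n x : ℕ) :
    mR N z c n (x + 1) - mR N z c n x = ∑ k ∈ Finset.range N,
      (n.choose (k + 1) : ℝ) * (x.choose k : ℝ) *
        (((k + 1).factorial : ℝ) / poch c (k + 1) * z ^ (k + 1)) := by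
  unfold mR
  rw [Finset.sum_range_succ', Finset.sum_range_succ' _ N]
  simp only [Nat.choose_zero_right]
  rw [add_sub_add_right_eq_sub, ← Finset.sum_sub_distrib]
  apply Finset.sum_congr rfl
  intro k _
  rw [Nat.choose_succ_succ x k]
  push_cast
  ring

lemma mR_rec (N : ℕ) (z c : ℝ) (hc : ∀ n : ℕ, c ≠ -(n : ℝ)) (n x : ℕ) (hn : n < N) :
    mP c (n + 1) * (mR N z c (n + 1) (x + 1) - mR N z c (n + 1) x) =
      mP c n * (mR N z c n (x + 1) - mR N z c n x) + z * (mP c n * mR N z c n x) := by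
  rw [mR_diff, mR_diff]
  unfold mR
  rw [Finset.sum_range_succ _ N, Nat.choose_eq_zero_of_lt hn]
  simp only [Nat.cast_zero, zero_mul, add_zero, Finset.mul_sum]
  rw [← Finset.sum_add_distrib]
  apply Finset.sum_congr rfl
  intro k _
  have e1 : ((n + 1).choose (k + 1) : ℝ) * (k + 1) = (n + 1) * n.choose k := by
    have := Nat.add_one_mul_choose_eq n k
    exact_mod_cast this.symm
  have e2 : ((n + 1).choose (k + 1) : ℝ) = n.choose k + n.choose (k + 1) := by
    rw [Nat.choose_succ_succ]; push_cast; ring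
  have hk := poch_ne c hc k
  have hck : c + k ≠ 0 := fun h => hc k (by linarith)
  have h3 : (Nat.factorial n : ℝ) ≠ 0 := by positivity
  have h4 : (n : ℝ) + 1 ≠ 0 := by positivity
  unfold mP
  rw [poch_succ, poch_succ, Nat.factorial_succ n, Nat.factorial_succ k]
  push_cast
  have e3 : (n.choose (k + 1) : ℝ) = (n + 1).choose (k + 1) - n.choose k := by linarith
  rw [e3]
  have e4 : (n.choose k : ℝ) = ((n + 1).choose (k + 1) : ℝ) * (k + 1) / (n + 1) := by
    field_simp; linarith
  rw [e4, pow_succ]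
  field_simp
  ring

lemma mT_eq (N : ℕ) (b c : ℝ) (hc : ∀ n : ℕ, c ≠ -(n : ℝ)) (x : ℕ) :
    ∀ n ≤ N, mT b c n (x : ℝ) = (-1) ^ n * (mP c n * mR N (1 - b) c n x) := by
  induction x with
  | zero =>
    intro n _
    rw [mR_symm, mR_zero_left, mul_one, Nat.cast_zero, mT_zero]
  | succ x ihx =>
    intro n
    induction n with
    | zero =>
      intro _
      rw [mR_zero_left]
      simp [mT, gbinom_zero, mP, poch]
    | succ n ihn =>
      intro hn
      have h1 := ihn (by omega)
      have h2 := ihx (n + 1) hn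
      have h3 := ihx n (by omega)
      have h4 := mT_rec b c n (x : ℝ)
      have h5 := mR_rec N (1 - b) c hc n x (by omega)
      push_cast at h1 ⊢
      rw [h1, h2, h3] at h4
      have h6 : mT b c (n + 1) ((x : ℝ) + 1) = (-1) ^ (n + 1) * (mP c (n + 1) * mR N (1 - b) c (n + 1) x)
        + b * ((-1) ^ n * (mP c n * mR N (1 - b) c n x)) -
        (-1) ^ n * (mP c n * mR N (1 - b) c n (x + 1)) := by linarith
      rw [h6, pow_succ]
      linear_combination (-(-1) ^ n * (-1)) * h5

lemma meixner_eq (a c : ℝ) (ha1 : a ≠ 1) (hc : ∀ n : ℕ, c ≠ -(n : ℝ)) (N n x : ℕ) (hn : n ≤ N) :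
    meixner a c n (x : ℝ) = (a / (a - 1)) ^ n * mP c n * mR N (1 - a⁻¹) c n x := by
  have h : meixner a c n (x : ℝ) = (a / (1 - a)) ^ n * mT a⁻¹ c n x := by
    unfold meixner mT
    congr 1
    apply Finset.sum_congr rfl
    intro j _
    rw [zpow_neg, zpow_natCast, inv_pow]
  rw [h, mT_eq N _ c hc x n hn]
  have : a / (a - 1) = a / (1 - a) * (-1) := by
    have h1 : a - 1 ≠ 0 := sub_ne_zero.2 ha1
    have h2 : 1 - a ≠ 0 := sub_ne_zero.2 ha1.symm
    field_simp
    ring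
  rw [this, mul_pow]
  ring

/-- Self-duality of the Meixner polynomials. -/
lemma meixner_dual (a c : ℝ) (ha0 : a ≠ 0) (ha1 : a ≠ 1) (hc : ∀ n : ℕ, c ≠ -(n : ℝ)) (n x : ℕ) :
    meixner a c n (x : ℝ) =
      ((a / (a - 1)) ^ n * mP c n) * ((((a - 1) / a) ^ x / mP c x) * meixner a c x (n : ℝ)) := by
  rw [meixner_eq a c ha1 hc (n + x) n x (by omega), meixner_eq a c ha1 hc (n + x) x n (by omega),
    mR_symm]
  have h1 : a - 1 ≠ 0 := sub_ne_zero.2 ha1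
  have := mP_ne c hc x
  rw [div_pow, div_pow, div_pow]
  field_simp

lemma meixner_dual_inv (a c : ℝ) (ha0 : a ≠ 0) (ha1 : a ≠ 1) (hc : ∀ n : ℕ, c ≠ -(n : ℝ))
    (u j x : ℕ) :
    (-1) ^ j * meixner a⁻¹ c (u + j) (x : ℝ) =
      ((a / (a - 1)) ^ (u + j) * mP c (u + j)) * (((-1) ^ u / a ^ u * ((1 - a) ^ x / mP c x)) *
        (a ^ (-(j : ℤ)) * meixner a⁻¹ c x ((u : ℝ) + j))) := by
  have h1 : a - 1 ≠ 0 := sub_ne_zero.2 ha1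
  have h2 : 1 - a ≠ 0 := sub_ne_zero.2 ha1.symm
  have := mP_ne c hc x
  rw [meixner_dual a⁻¹ c (inv_ne_zero ha0) (by simpa using ha1) hc (u + j) x]
  have e1 : a⁻¹ / (a⁻¹ - 1) = (-1) * (a - 1)⁻¹ := by
    have : a⁻¹ - 1 ≠ 0 := by
      have : a⁻¹ - 1 = (1 - a) / a := by field_simp
      rw [this]; exact div_ne_zero h2 ha0
    field_simp
    ring
  have e2 : (a⁻¹ - 1) / a⁻¹ = 1 - a := by field_simp
  rw [e1, e2, zpow_neg, zpow_natCast, Nat.cast_add, mul_pow, inv_pow, div_pow, pow_add (-1 : ℝ), pow_add a]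
  have e3 : (-1 : ℝ) ^ j * (-1) ^ j = 1 := by rw [← mul_pow]; simp
  generalize meixner a⁻¹ c x ((u : ℝ) + j) = M
  generalize mP c (u + j) = Q
  generalize (-1 : ℝ) ^ j = s at *
  field_simp
  linear_combination (M * Q) * e3

lemma nth_prod (F : Finset ℕ) (g : ℕ → ℝ) :
    ∏ i ∈ Finset.range F.card, g (nth F i) = ∏ f ∈ F, g f := by
  have h1 : ∏ f ∈ F, g f = ((F.sort (· ≤ ·)).map g).prod := by
    conv_lhs => rw [← Finset.sort_toFinset F (· ≤ ·)]
    rw [List.prod_toFinset _ (Finset.sort_nodup _ _)]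
  rw [h1, ← Fin.prod_univ_getElem, Finset.prod_range]
  have hl : ((F.sort (· ≤ ·)).map g).length = F.card := by simp
  refine Fintype.prod_equiv (finCongr hl.symm) _ _ ?_
  intro i
  have hi : (i : ℕ) < (F.sort (· ≤ ·)).length := by simp
  simp [nth, List.getD_eq_getElem _ _ hi]

lemma c_pochZ (c : ℝ) (hc0 : c ≠ 0) (n : ℕ) : c * pochZ (1 + c) ((n : ℤ) - 1) = poch c n := by
  cases n with
  | zero => simp [pochZ, poch, hc0]
  | succ n =>
    simp only [pochZ, poch, Nat.cast_succ, add_sub_cancel_right, Int.toNat_natCast]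
    rw [if_pos (Int.natCast_nonneg n), Finset.prod_range_succ', mul_comm]
    simp only [Nat.cast_zero, add_zero]
    congr 1
    apply Finset.prod_congr rfl
    intro i _
    push_cast; ring

lemma c_poch (c : ℝ) (n : ℕ) (hn : 0 < n) : c * poch (1 + c) (n - 1) = poch c n := by
  obtain ⟨m, rfl⟩ : ∃ m, n = m + 1 := ⟨n - 1, by omega⟩
  simp only [poch, Nat.add_sub_cancel]
  rw [Finset.prod_range_succ', mul_comm]
  simp only [Nat.cast_zero, add_zero]
  congr 1
  apply Finset.prod_congr rfl
  intro i _
  push_cast; ring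

lemma choose_le_sum (F : Finset ℕ) (hF : ∀ f ∈ F, 0 < f) :
    Nat.choose (F.card + 1) 2 ≤ ∑ f ∈ F, f := by
  induction F using Finset.induction_on_max with
  | empty => simp
  | insert m s hm ih =>
    have hnot : m ∉ s := fun h => lt_irrefl _ (hm m h)
    rw [Finset.card_insert_of_notMem hnot, Finset.sum_insert hnot, Nat.choose_succ_succ]
    have h1 := ih fun f hf => hF f (Finset.mem_insert_of_mem hf)
    have h2 : s ⊆ Finset.Ioo 0 m := fun f hf =>
      Finset.mem_Ioo.2 ⟨hF f (Finset.mem_insert_of_mem hf), hm f hf⟩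
    have h3 := Finset.card_le_card h2
    have h4 := hF m (Finset.mem_insert_self _ _)
    simp only [Nat.card_Ioo] at h3
    simp only [Nat.choose_one_right]
    have h5 : Nat.choose (s.card + 1) (Nat.succ 1) = Nat.choose (s.card + 1) 2 := rfl
    omega

lemma det_eq (a c : ℝ) (ha0 : a ≠ 0) (ha1 : a ≠ 1)
    (hc : ∀ n : ℕ, c ≠ -(n : ℝ)) (F1 F2 : Finset ℕ) (u v : ℕ) (hv : uF F1 F2 ≤ v) :
    Matrix.det (Matrix.of fun i j : Fin (F1.card + F2.card + 1) =>
    if (i : ℕ) = 0 then meixner a c (u + (j : ℕ)) ((v : ℝ) - (uF F1 F2 : ℝ))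
    else if (i : ℕ) - 1 < F1.card then
      meixner a c (u + (j : ℕ)) ((nth F1 ((i : ℕ) - 1) : ℝ))
    else (-1 : ℝ) ^ (j : ℕ) *
      meixner a⁻¹ c (u + (j : ℕ)) ((nth F2 ((i : ℕ) - 1 - F1.card) : ℝ))) =
    (∏ j ∈ Finset.range (F1.card + F2.card + 1), ((a / (a - 1)) ^ (u + j) * mP c (u + j))) *
    ((((a - 1) / a) ^ (v - uF F1 F2) / mP c (v - uF F1 F2)) *
      (∏ f ∈ F1, (((a - 1) / a) ^ f / mP c f)) *
      (∏ f ∈ F2, ((-1) ^ u / a ^ u * ((1 - a) ^ f / mP c f)))) * mExc a c F1 F2 v (u : ℝ) := by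
  have hr : (((a - 1) / a) ^ (v - uF F1 F2) / mP c (v - uF F1 F2)) *
      (∏ f ∈ F1, (((a - 1) / a) ^ f / mP c f)) *
      (∏ f ∈ F2, ((-1) ^ u / a ^ u * ((1 - a) ^ f / mP c f))) =
      ∏ i : Fin (F1.card + F2.card + 1), (fun i : Fin (F1.card + F2.card + 1) =>
        if (i : ℕ) = 0 then (((a - 1) / a) ^ (v - uF F1 F2) / mP c (v - uF F1 F2))
        else if (i : ℕ) - 1 < F1.card then
          (((a - 1) / a) ^ (nth F1 ((i : ℕ) - 1)) / mP c (nth F1 ((i : ℕ) - 1)))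
        else ((-1) ^ u / a ^ u * ((1 - a) ^ (nth F2 ((i : ℕ) - 1 - F1.card)) /
          mP c (nth F2 ((i : ℕ) - 1 - F1.card))))) i := by
    rw [Fin.prod_univ_succ, ← nth_prod F1, ← nth_prod F2, mul_assoc]
    simp only [Fin.val_zero, if_true, Fin.val_succ, Nat.add_eq_zero_iff, one_ne_zero, and_false,
      if_false, Nat.add_sub_cancel]
    congr 1
    rw [Fin.prod_univ_add, Finset.prod_range, Finset.prod_range]
    congr 1
    · apply Finset.prod_congr rfl
      intro i _
      simp
    · apply Finset.prod_congr rfl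
      intro i _
      simp
  rw [hr, Finset.prod_range, mul_assoc, mExc, ← Matrix.det_mul_column, ← Matrix.det_mul_row]
  congr 1
  ext i j
  simp only [Matrix.of_apply]
  split_ifs with h1 h2
  · rw [← Nat.cast_sub hv, meixner_dual a c ha0 ha1 hc]
    push_cast; rfl
  · rw [meixner_dual a c ha0 ha1 hc]
    push_cast; rfl
  · rw [meixner_dual_inv a c ha0 ha1 hc]

/-- Duality (Lemma 3.2): for every nonnegative integer `u` and every `v ∈ σ_𝓕`,
`q_u^𝓕(v) = κ ξ_u ζ_v m_v^{a,c;𝓕}(u)`. -/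
theorem meixner_duality (a c : ℝ) (ha0 : a ≠ 0) (ha1 : a ≠ 1)
    (hc : ∀ n : ℕ, c ≠ -(n : ℝ))
    (F1 F2 : Finset ℕ) (hF1 : ∀ f ∈ F1, 0 < f) (hF2 : ∀ f ∈ F2, 0 < f)
    (hne : F1.Nonempty ∨ F2.Nonempty)
    (u v : ℕ) (hv : v ∈ sigmaF F1 F2) :
    qExc a c F1 F2 u (v : ℝ) =
      ((-1 : ℝ) ^ (∑ f ∈ F2, f) * a ^ (F2.card * (F1.card + 1) + ∑ f ∈ F2, f) *
          (∏ f ∈ F1, (Nat.factorial f : ℝ)) * (∏ f ∈ F2, (Nat.factorial f : ℝ)) /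
        ((a - 1) ^ (F2.card * (F1.card + 1)) *
          (∏ f ∈ F1, poch (1 + c) (f - 1)) * (∏ f ∈ F2, poch (1 + c) (f - 1)))) *
      (a ^ ((F1.card + 1) * u) *
          (∏ i ∈ Finset.range (F1.card + F2.card + 1), pochZ (1 + c) ((u : ℤ) + (i : ℤ) - 1)) /
        ((a - 1) ^ ((F1.card + F2.card + 1) * u) *
          (∏ i ∈ Finset.range (F1.card + F2.card + 1), (Nat.factorial (u + i) : ℝ)))) *
      ((a - 1) ^ v * (Nat.factorial (v - uF F1 F2) : ℝ) /
        (a ^ v * pochZ (1 + c) ((v : ℤ) - (uF F1 F2 : ℤ) - 1) *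
          (∏ f ∈ F1, ((v : ℝ) - (f : ℝ) - (uF F1 F2 : ℝ))) *
          (∏ f ∈ F2, ((v : ℝ) + c + (f : ℝ) - (uF F1 F2 : ℝ))))) *
      mExc a c F1 F2 v (u : ℝ) := by
  rw [qExc, det_eq a c ha0 ha1 hc F1 F2 u v hv.1]
  have hc0 : c ≠ 0 := by simpa using hc 0
  have hd : a - 1 ≠ 0 := sub_ne_zero.2 ha1
  obtain ⟨w, rfl⟩ : ∃ w, v = uF F1 F2 + w := ⟨v - uF F1 F2, by have := hv.1; omega⟩
  generalize mExc a c F1 F2 (uF F1 F2 + w) (u : ℝ) = M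
  generalize (∏ f ∈ F1, (((uF F1 F2 + w : ℕ) : ℝ) - (f : ℝ) - (uF F1 F2 : ℝ))) = D1
  generalize (∏ f ∈ F2, (((uF F1 F2 + w : ℕ) : ℝ) + c + (f : ℝ) - (uF F1 F2 : ℝ))) = D2
  have hZ : ∀ n : ℕ, pochZ (1 + c) ((n : ℤ) - 1) = mP c n * n.factorial / c := by
    intro n
    have := c_pochZ c hc0 n
    have h3 : (Nat.factorial n : ℝ) ≠ 0 := by positivity
    unfold mP
    field_simp
    linarith
  have hw : ((uF F1 F2 + w : ℕ) : ℤ) - (uF F1 F2 : ℤ) - 1 = (w : ℤ) - 1 := by push_cast; ring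
  have hcol : ∀ i ∈ Finset.range (F1.card + F2.card + 1),
      pochZ (1 + c) ((u : ℤ) + (i : ℤ) - 1) = mP c (u + i) * (u + i).factorial / c := by
    intro i _
    rw [← hZ]; push_cast; rfl
  have hp : ∀ F : Finset ℕ, (∀ f ∈ F, 0 < f) → ∏ f ∈ F, poch (1 + c) (f - 1) =
      (∏ f ∈ F, mP c f) * (∏ f ∈ F, (f.factorial : ℝ)) / c ^ F.card := by
    intro F hF
    rw [← Finset.prod_mul_distrib, ← Finset.prod_const, ← Finset.prod_div_distrib]
    apply Finset.prod_congr rfl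
    intro f hf
    have := c_poch c f (hF f hf)
    have h3 : (Nat.factorial f : ℝ) ≠ 0 := by positivity
    unfold mP
    field_simp
    linarith
  rw [hw, hZ, Finset.prod_congr rfl hcol, hp F1 hF1, hp F2 hF2, Nat.add_sub_cancel_left]
  have hpow : ∀ (F : Finset ℕ) (x : ℝ), ∏ f ∈ F, x ^ f = x ^ (∑ f ∈ F, f) :=
    fun F x => Finset.prod_pow_eq_pow_sum F (fun f => f) x
  have hpow2 : ∀ (F : Finset ℕ) (x : ℝ),
      ∏ f ∈ F, x ^ (u + f) = x ^ (F.card * u + ∑ f ∈ F, f) := by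
    intro F x
    rw [Finset.prod_pow_eq_pow_sum F (fun f => u + f) x, Finset.sum_add_distrib, Finset.sum_const,
      smul_eq_mul]
  simp only [Finset.prod_div_distrib, Finset.prod_mul_distrib, Finset.prod_const,
    Finset.card_range, hpow, hpow2]
  have hne1 : ∀ F : Finset ℕ, ∏ f ∈ F, mP c f ≠ 0 := fun F =>
    Finset.prod_ne_zero_iff.2 fun f _ => mP_ne c hc f
  have hne2 : ∀ F : Finset ℕ, ∏ f ∈ F, (f.factorial : ℝ) ≠ 0 := fun F =>
    Finset.prod_ne_zero_iff.2 fun f _ => by positivity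
  have hne3 : ∏ i ∈ Finset.range (F1.card + F2.card + 1), ((u + i).factorial : ℝ) ≠ 0 :=
    Finset.prod_ne_zero_iff.2 fun f _ => by positivity
  have hne4 : (w.factorial : ℝ) ≠ 0 := by positivity
  have n1 := hne1 F1
  have n2 := hne1 F2
  have n3 := hne2 F1
  have n4 := hne2 F2
  have n5 := mP_ne c hc w
  have hE : uF F1 F2 + ∑ i ∈ Finset.range (F1.card + F2.card + 1), 0 = uF F1 F2 := by simp
  have hU : uF F1 F2 + ∑ i ∈ Finset.range (F1.card + F2.card + 1), i =
      ∑ f ∈ F1, f + ∑ f ∈ F2, f + F2.card * (F1.card + 1) := by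
    have g1 := choose_le_sum F1 hF1
    have g2 := choose_le_sum F2 hF2
    have g3 : Nat.choose F2.card 2 ≤ Nat.choose (F2.card + 1) 2 :=
      Nat.choose_le_choose 2 (Nat.le_succ _)
    have g4 : ∑ i ∈ Finset.range (F1.card + F2.card + 1), i =
        Nat.choose (F1.card + 1) 2 + Nat.choose F2.card 2 + F2.card * (F1.card + 1) := by
      rw [Finset.sum_range_id, ← Nat.choose_two_right]
      have e : F1.card + F2.card + 1 = (F1.card + 1) + F2.card := by ring
      rw [e]
      qify
      rw [Nat.cast_choose_two, Nat.cast_choose_two, Nat.cast_choose_two]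
      push_cast
      ring
    rw [g4]
    unfold uF
    omega
  have hs1 : ((1 : ℝ) - a) = (-1) * (a - 1) := by ring
  rw [hs1]
  generalize (∏ f ∈ F1, mP c f) = A1 at *
  generalize (∏ f ∈ F2, mP c f) = A2 at *
  generalize (∏ f ∈ F1, (f.factorial : ℝ)) = B1 at *
  generalize (∏ f ∈ F2, (f.factorial : ℝ)) = B2 at *
  generalize (∏ i ∈ Finset.range (F1.card + F2.card + 1), ((u + i).factorial : ℝ)) = B3 at *
  generalize (∏ i ∈ Finset.range (F1.card + F2.card + 1), mP c (u + i)) = A3 at *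
  generalize (∑ i ∈ Finset.range (F1.card + F2.card + 1), i) = S at *
  generalize (∑ f ∈ F1, f) = S1 at *
  generalize (∑ f ∈ F2, f) = S2 at *
  generalize uF F1 F2 = U at *
  generalize F1.card = k1 at *
  generalize F2.card = k2 at *
  generalize a - 1 = d at *
  generalize mP c w = P at *
  clear hE hpow hpow2 hZ hp hcol hv hne hne1 hne2 hw hF1 hF2 hs1
  have key : (a / d) ^ ((k1 + k2 + 1) * u + S) * ((d / a) ^ w * (d / a) ^ S1 *
      (((-1) ^ u / a ^ u) ^ k2 * ((-1) * d) ^ S2)) =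
      (-1) ^ (u * k2) * ((-1) ^ S2 * a ^ (k2 * (k1 + 1) + S2) / d ^ (k2 * (k1 + 1)) *
      (a ^ ((k1 + 1) * u) / d ^ ((k1 + k2 + 1) * u)) * (d ^ (U + w) / a ^ (U + w))) := by
    have hq : a / d ≠ 0 := div_ne_zero ha0 hd
    have e : d / a = (a / d)⁻¹ := by rw [inv_div]
    have e2 : (a / d) ^ U * (a / d) ^ S = (a / d) ^ S1 * (a / d) ^ S2 * (a / d) ^ (k2 * (k1 + 1)) := by
      rw [← pow_add, ← pow_add, ← pow_add, hU]
    have e3 : d ^ (U + w) / a ^ (U + w) = ((a / d) ^ U)⁻¹ * ((a / d) ^ w)⁻¹ := by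
      rw [← div_pow, e, inv_pow, pow_add, mul_inv]
    have e4 : (a / d) ^ S = (a / d) ^ S1 * (a / d) ^ S2 * (a / d) ^ (k2 * (k1 + 1)) / (a / d) ^ U := by
      rw [← e2]; field_simp
    rw [e3, pow_add (a / d), e4, e, inv_pow, inv_pow, mul_pow (-1 : ℝ) d]
    have e5 : ((-1 : ℝ) ^ u / a ^ u) ^ k2 = (-1) ^ (u * k2) / a ^ (u * k2) := by
      rw [div_pow, ← pow_mul, ← pow_mul]
    have e6 : (a / d) ^ ((k1 + k2 + 1) * u) = a ^ (u * k2) * (a ^ ((k1 + 1) * u) / d ^ ((k1 + k2 + 1) * u)) := by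
      rw [div_pow, ← mul_div_assoc, ← pow_add]
      congr 2; ring
    rw [e5, e6, pow_add a, div_pow a d S2, div_pow a d (k2 * (k1 + 1))]
    have q1 : (a / d) ^ U ≠ 0 := pow_ne_zero _ hq
    have q2 : (a / d) ^ w ≠ 0 := pow_ne_zero _ hq
    have q3 : (a / d) ^ S1 ≠ 0 := pow_ne_zero _ hq
    generalize (a / d) ^ U = X1 at *
    generalize (a / d) ^ w = X2 at *
    generalize (a / d) ^ S1 = X3 at *
    have q4 := pow_ne_zero (u * k2) ha0
    have q5 := pow_ne_zero ((k1 + 1) * u) ha0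
    have q6 := pow_ne_zero S2 ha0
    have q7 := pow_ne_zero (k2 * (k1 + 1)) ha0
    have q8 := pow_ne_zero ((k1 + k2 + 1) * u) hd
    have q9 := pow_ne_zero (k2 * (k1 + 1)) hd
    have q10 := pow_ne_zero S2 hd
    generalize a ^ (u * k2) = Y1 at *
    generalize a ^ ((k1 + 1) * u) = Y2 at *
    generalize a ^ S2 = Y3 at *
    generalize a ^ (k2 * (k1 + 1)) = Y4 at *
    generalize d ^ ((k1 + k2 + 1) * u) = Y5 at *
    generalize d ^ (k2 * (k1 + 1)) = Y6 at *
    generalize d ^ S2 = Y7 at *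
    field_simp
  have hm : ((-1 : ℝ) ^ (u * k2)) ≠ 0 := pow_ne_zero _ (by norm_num)
  have hcc : c ^ (k1 + k2 + 1) = c ^ k1 * c ^ k2 * c := by rw [pow_add, pow_add, pow_one]
  have L : ∀ X Y : ℝ, X = (-1) ^ (u * k2) * Y → 
      X * (A3 / (P * A1 * A2)) * M / ((-1) ^ (u * k2) * D1 * D2) =
      Y * (A3 / (P * A1 * A2)) * M / (D1 * D2) := by
    rintro X Y rfl
    rw [mul_assoc ((-1 : ℝ) ^ (u * k2)) D1, mul_assoc ((-1 : ℝ) ^ (u * k2)) Y,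
      mul_assoc ((-1 : ℝ) ^ (u * k2)) _, mul_div_mul_left _ _ hm]
  have L' := L _ _ key
  rw [hcc]
  have hck1 := pow_ne_zero k1 hc0
  have hck2 := pow_ne_zero k2 hc0
  generalize c ^ k1 = C1 at *
  generalize c ^ k2 = C2 at *
  refine Eq.trans ?_ (L'.trans ?_)
  · congr 1
    simp only [div_eq_mul_inv, mul_inv]
    ring
  · have r : A3 / (P * A1 * A2) = B1 * B2 / (A1 * B1 / C1 * (A2 * B2 / C2)) *
        (A3 * B3 / (C1 * C2 * c) / B3) * (w.factorial / (P * w.factorial / c)) := by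
      field_simp
    rw [r]
    simp only [div_eq_mul_inv, mul_inv]
    ring
end
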